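/- For every positive integer n, \(\sum_{k=0}^{n} \binom{2n}{n+k} F_{k}^{2} = 5^{n-1}\). -/

import Mathlib

/-- The symmetric form of the binomial theorem for `(x + 2 + x⁻¹) ^ n`, where `y` plays the role of
`x⁻¹`; the central term is counted twice on the left. -/
theorem sum_choose_mul_pow_add_pow {R : Type*} [CommRing R] {x y : R} (hxy : x * y = 1) (n : ℕ) :
    ∑ k ∈ Finset.range (n + 1), ((2 * n).choose (n + k) : R) * (x ^ k + y ^ k) =
      ((2 * n).choose n : R) + (x + y + 2) ^ n := by
  have expand : (x + y + 2) ^ n =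
      ∑ j ∈ Finset.range (n + (n + 1)), ((2 * n).choose j : R) * (x ^ j * y ^ n) := by
    have hbase : x + y + 2 = (x + 1) ^ 2 * y := by linear_combination (-x - 2) * hxy
    rw [hbase, mul_pow, ← pow_mul, add_pow, Finset.sum_mul,
      show n + (n + 1) = 2 * n + 1 by ring]
    exact Finset.sum_congr rfl fun j _ => by rw [one_pow]; ring
  have upper : ∀ k, x ^ (n + k) * y ^ n = x ^ k := fun k => by
    rw [pow_add, mul_right_comm, ← mul_pow, hxy, one_pow, one_mul]
  have lower : ∑ j ∈ Finset.range n, ((2 * n).choose j : R) * (x ^ j * y ^ n) =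
      ∑ k ∈ Finset.range n, ((2 * n).choose (n + (k + 1)) : R) * y ^ (k + 1) := by
    rw [← Finset.sum_range_reflect]
    refine Finset.sum_congr rfl fun k hk => ?_
    obtain ⟨m, rfl⟩ := Nat.exists_eq_add_of_lt (Finset.mem_range.mp hk)
    rw [show k + m + 1 - 1 - k = m by omega,
      Nat.choose_symm_of_eq_add (show 2 * (k + m + 1) = m + (k + m + 1 + (k + 1)) by ring),
      show k + m + 1 = m + (k + 1) by ring, pow_add y, ← mul_assoc (x ^ m), ← mul_pow, hxy,
      one_pow, one_mul]
  rw [expand, Finset.sum_range_add _ n (n + 1), lower]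
  simp only [upper, mul_add, Finset.sum_add_distrib]
  rw [Finset.sum_range_succ' (fun k => ((2 * n).choose (n + k) : R) * y ^ k)]
  simp only [add_zero, pow_zero, mul_one]
  ring

/-- Binet's formula, squared. -/
theorem five_mul_fib_sq (k : ℕ) :
    5 * (Nat.fib k : ℝ) ^ 2 =
      ((Real.goldenRatio ^ 2) ^ k + (Real.goldenConj ^ 2) ^ k) - ((-1) ^ k + (-1) ^ k) := by
  have h5 : (√5 : ℝ) ^ 2 = 5 := Real.sq_sqrt (by norm_num)
  have hprod : Real.goldenRatio ^ k * Real.goldenConj ^ k = (-1) ^ k := by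
    rw [← mul_pow, Real.goldenRatio_mul_goldenConj]
  rw [Real.coe_fib_eq, div_pow, h5, mul_div_cancel₀ _ (by norm_num : (5 : ℝ) ≠ 0),
    pow_right_comm, pow_right_comm Real.goldenConj]
  linear_combination (-2) * hprod

/-- For every positive integer `n`, `∑_{k=0}^n C(2n, n+k) F_k² = 5^{n-1}`. -/
theorem sum_choose_fib_sq (n : ℕ) (hn : 0 < n) :
    ∑ k ∈ Finset.range (n + 1), Nat.choose (2 * n) (n + k) * Nat.fib k ^ 2 =
      5 ^ (n - 1) := by
  have hprod : Real.goldenRatio ^ 2 * Real.goldenConj ^ 2 = 1 := by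
    rw [← mul_pow, Real.goldenRatio_mul_goldenConj]; norm_num
  have hsum : Real.goldenRatio ^ 2 + Real.goldenConj ^ 2 + 2 = 5 := by
    rw [Real.goldenRatio_sq, Real.goldenConj_sq]
    linear_combination Real.goldenRatio_add_goldenConj
  have golden := sum_choose_mul_pow_add_pow hprod n
  have alternating := sum_choose_mul_pow_add_pow (show (-1 : ℝ) * (-1) = 1 by norm_num) n
  rw [hsum] at golden
  rw [show (-1 : ℝ) + -1 + 2 = 0 by norm_num, zero_pow hn.ne'] at alternating
  have key : (5 : ℝ) * ∑ k ∈ Finset.range (n + 1),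
      ((2 * n).choose (n + k) : ℝ) * (Nat.fib k : ℝ) ^ 2 = 5 ^ n := by
    simp only [Finset.mul_sum, mul_left_comm (5 : ℝ), five_mul_fib_sq, mul_sub _ (_ + _),
      Finset.sum_sub_distrib]
    linear_combination golden - alternating
  apply Nat.eq_of_mul_eq_mul_left (show 0 < 5 by norm_num)
  rw [mul_pow_sub_one hn.ne']
  exact_mod_cast key
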